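/- arXiv:1112.5696 — 2 statements merged into one kernel-verified Lean document; each statement's English description precedes it below -/
import Mathlib

section
/- For all integers r > 2 and s > 1 and all τ ∈ ℍ, Z^{𝐞𝐨}_{r,s}(τ) = Σ_{m > m′ > 0, m even, m′ odd} φ_r(mτ) φ_s(m′τ), the sum being over integers m > m′ > 0 with m even and m′ odd. -/
noncomputable section

open Complex

/-- `φ_k(z) = ((-1)^k/(k-1)!) ∑_{u≥1} u^{k-1} e^{2πiz·u}`. -/
def phi (k : ℕ) (z : ℂ) : ℂ :=
  ((-1 : ℂ) ^ k / (Nat.factorial (k - 1) : ℂ)) *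
    ∑' u : ℕ, ((u : ℂ) + 1) ^ (k - 1) * Complex.exp (2 * ↑Real.pi * Complex.I * z) ^ (u + 1)

/-- `f^𝐨_r(τ) = ∑_{m odd, m>0} φ_r(mτ)`. -/
def fo (r : ℕ) (τ : ℂ) : ℂ := ∑' m : ℕ, phi r ((2 * (m : ℂ) + 1) * τ)

/-- `f^𝐞_r(τ) = ∑_{m even, m>0} φ_r(mτ)`. -/
def fe (r : ℕ) (τ : ℂ) : ℂ := ∑' m : ℕ, phi r ((2 * (m : ℂ) + 2) * τ)

/-- `f̄^𝐨_s(τ) = -∑_{m odd, m>0} m φ_{s+1}(mτ)`. -/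
def fbo (s : ℕ) (τ : ℂ) : ℂ :=
  -∑' m : ℕ, (2 * (m : ℂ) + 1) * phi (s + 1) ((2 * (m : ℂ) + 1) * τ)

/-- `f̄^𝐞_s(τ) = -∑_{m even, m>0} m φ_{s+1}(mτ)`. -/
def fbe (s : ℕ) (τ : ℂ) : ℂ :=
  -∑' m : ℕ, (2 * (m : ℂ) + 2) * phi (s + 1) ((2 * (m : ℂ) + 2) * τ)

/-- `f^{𝐞𝐨}_{r,s}(τ) = ∑_{m>m'>0, m even, m' odd} φ_r(mτ)φ_s(m'τ)`. -/
def feo (r s : ℕ) (τ : ℂ) : ℂ :=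
  ∑' x : {p : ℤ × ℤ // 0 < p.2 ∧ p.2 < p.1 ∧ Even p.1 ∧ Odd p.2},
    phi r ((x.1.1 : ℂ) * τ) * phi s ((x.1.2 : ℂ) * τ)

/-- `f^{𝐨𝐞}_{r,s}(τ) = ∑_{m>m'>0, m odd, m' even} φ_r(mτ)φ_s(m'τ)`. -/
def foe (r s : ℕ) (τ : ℂ) : ℂ :=
  ∑' x : {p : ℤ × ℤ // 0 < p.2 ∧ p.2 < p.1 ∧ Odd p.1 ∧ Even p.2},
    phi r ((x.1.1 : ℂ) * τ) * phi s ((x.1.2 : ℂ) * τ)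

/-- `f^{𝐨𝐨}_{r,s}(τ) = ∑_{m>m'>0, m, m' odd} φ_r(mτ)φ_s(m'τ)`. -/
def foo (r s : ℕ) (τ : ℂ) : ℂ :=
  ∑' x : {p : ℤ × ℤ // 0 < p.2 ∧ p.2 < p.1 ∧ Odd p.1 ∧ Odd p.2},
    phi r ((x.1.1 : ℂ) * τ) * phi s ((x.1.2 : ℂ) * τ)

/-- `ζ̃(k) = (2πi)^{-k} ζ(k)` for `k ≥ 2`, and `ζ̃(1) = 0`. -/
def ztilde (k : ℕ) : ℂ :=
  if k = 1 then 0 else riemannZeta k * ((2 * ↑Real.pi * Complex.I) ^ k)⁻¹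

/-- `mτ + n > 0` means `m > 0`, or `m = 0` and `n > 0`. -/
def posL (m n : ℤ) : Prop := 0 < m ∨ (m = 0 ∧ 0 < n)

/-- The double Eisenstein series `Z^{𝐞𝐨}_{r,s}(τ)`: the sum over
`m ∈ 𝐞, m' ∈ 𝐨, n, n' ∈ ℤ` with `mτ+n > m'τ+n' > 0` of
`(2πi)^{-r-s}/((mτ+n)^r (m'τ+n')^s)`. -/
def ZeoSeries (r s : ℕ) (τ : ℂ) : ℂ :=
  ((2 * ↑Real.pi * Complex.I) ^ (r + s))⁻¹ *
    ∑' x : {x : (ℤ × ℤ) × (ℤ × ℤ) // Even x.1.1 ∧ Odd x.2.1 ∧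
        posL (x.1.1 - x.2.1) (x.1.2 - x.2.2) ∧ posL x.2.1 x.2.2},
      1 / (((x.1.1.1 : ℂ) * τ + (x.1.1.2 : ℂ)) ^ r * ((x.1.2.1 : ℂ) * τ + (x.1.2.2 : ℂ)) ^ s)

/-- The double Eisenstein series `Z^{𝐨𝐞}_{r,s}(τ)` (now `m ∈ 𝐨`, `m' ∈ 𝐞`). -/
def ZoeSeries (r s : ℕ) (τ : ℂ) : ℂ :=
  ((2 * ↑Real.pi * Complex.I) ^ (r + s))⁻¹ *
    ∑' x : {x : (ℤ × ℤ) × (ℤ × ℤ) // Odd x.1.1 ∧ Even x.2.1 ∧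
        posL (x.1.1 - x.2.1) (x.1.2 - x.2.2) ∧ posL x.2.1 x.2.2},
      1 / (((x.1.1.1 : ℂ) * τ + (x.1.1.2 : ℂ)) ^ r * ((x.1.2.1 : ℂ) * τ + (x.1.2.2 : ℂ)) ^ s)

/-- The double Eisenstein series `Z^{𝐨𝐨}_{r,s}(τ)` (now `m, m' ∈ 𝐨`). -/
def ZooSeries (r s : ℕ) (τ : ℂ) : ℂ :=
  ((2 * ↑Real.pi * Complex.I) ^ (r + s))⁻¹ *
    ∑' x : {x : (ℤ × ℤ) × (ℤ × ℤ) // Odd x.1.1 ∧ Odd x.2.1 ∧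
        posL (x.1.1 - x.2.1) (x.1.2 - x.2.2) ∧ posL x.2.1 x.2.2},
      1 / (((x.1.1.1 : ℂ) * τ + (x.1.1.2 : ℂ)) ^ r * ((x.1.2.1 : ℂ) * τ + (x.1.2.2 : ℂ)) ^ s)

/-- The Lipschitz formula in terms of `phi`. -/
lemma tsum_one_div_add_int_pow {k : ℕ} (hk : 1 < k) {z : ℂ} (hz : 0 < z.im) :
    ∑' n : ℤ, 1 / (z + n) ^ k = (2 * ↑Real.pi * I) ^ k * phi k z := by
  obtain ⟨j, rfl⟩ : ∃ j, k = j + 1 := ⟨k - 1, by omega⟩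
  have hj : j ≠ 0 := by omega
  have h := EisensteinSeries.qExpansion_identity (k := j) (by omega) ⟨z, hz⟩
  have hsum := summable_pow_mul_cexp j 1 ⟨z, hz⟩
  simp only [PNat.val_ofNat, Nat.cast_one, mul_one] at h hsum
  rw [h, hsum.tsum_eq_zero_add, phi]
  have hneg : (-2 * (Real.pi : ℂ) * I) ^ (j + 1)
      = (2 * (Real.pi : ℂ) * I) ^ (j + 1) * (-1) ^ (j + 1) := by
    rw [← mul_pow]; ring
  rw [hneg]
  simp only [Nat.cast_zero, zero_pow hj, zero_mul, zero_add, Nat.add_sub_cancel, Nat.cast_add,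
    Nat.cast_one]
  ring

lemma summable_one_div_add_int_pow {k : ℕ} (hk : 1 < k) (z : ℂ) :
    Summable fun n : ℤ ↦ 1 / (z + n) ^ k := by
  have h := EisensteinSeries.linear_right_summable z 1 (k := k) (by omega)
  simpa [one_div] using h

/-- A lattice point `mτ + n` with `m ≥ 1` is bounded below by a multiple of `max m |n|`. -/
lemma exists_mul_max_le_norm {τ : ℂ} (hτ : 0 < τ.im) :
    ∃ ρ : ℝ, 0 < ρ ∧ ∀ m n : ℤ, 0 < m →
      ρ * max (m : ℝ) |(n : ℝ)| ≤ ‖(m : ℂ) * τ + n‖ := by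
  refine ⟨EisensteinSeries.r ⟨τ, hτ⟩, EisensteinSeries.r_pos _, fun m n hm ↦ ?_⟩
  have hne : ![m, n] ≠ 0 := fun h ↦ hm.ne' (congrFun h 0)
  have h := EisensteinSeries.r_mul_max_le ⟨τ, hτ⟩ hne
  simpa [EisensteinSeries.norm_eq_max_natAbs, Nat.cast_natAbs,
    abs_of_pos (Int.cast_pos.mpr hm : (0 : ℝ) < m)] using h

lemma summable_max_abs_one_rpow {a : ℝ} (ha : 1 < a) :
    Summable fun n : ℤ ↦ (max |(n : ℝ)| 1) ^ (-a) := by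
  refine summable_of_isBigO (Real.summable_abs_int_rpow ha)
    (Asymptotics.IsBigO.of_bound 1 ?_)
  filter_upwards [(Set.finite_singleton (0 : ℤ)).compl_mem_cofinite] with n hn
  have h1 : (1 : ℝ) ≤ |(n : ℝ)| := by
    have : 1 ≤ |n| := Int.one_le_abs (by simpa using hn)
    exact_mod_cast this
  rw [max_eq_left h1, one_mul]

lemma rpow_mul_le_pow_mul_pow {a b c d M M' : ℝ} {r s : ℕ} (hr : 2 < r) (hs : 1 < s)
    (ha : 1 ≤ a) (hb : 1 ≤ b) (hc : 1 ≤ c) (hd : 1 ≤ d) (haM : a ≤ M) (hbM : b ≤ M)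
    (hcM : c ≤ M) (hcM' : c ≤ M') (hdM' : d ≤ M') :
    (a ^ (5 / 4 : ℝ) * c ^ (5 / 4 : ℝ)) * (b ^ (5 / 4 : ℝ) * d ^ (5 / 4 : ℝ))
      ≤ M ^ r * M' ^ s := by
  have hM : 1 ≤ M := ha.trans haM
  have hM' : 1 ≤ M' := hc.trans hcM'
  have hM3 : M ^ (5 / 4 : ℝ) * M ^ (5 / 4 : ℝ) * M ^ (1 / 2 : ℝ) = M ^ 3 := by
    rw [← Real.rpow_add (by linarith), ← Real.rpow_add (by linarith), ← Real.rpow_natCast]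
    norm_num
  have hM2 : M' ^ (3 / 4 : ℝ) * M' ^ (5 / 4 : ℝ) = M' ^ 2 := by
    rw [← Real.rpow_add (by linarith), ← Real.rpow_natCast]
    norm_num
  have hc5 : c ^ (5 / 4 : ℝ) = c ^ (1 / 2 : ℝ) * c ^ (3 / 4 : ℝ) := by
    rw [← Real.rpow_add (by linarith)]
    norm_num
  calc (a ^ (5 / 4 : ℝ) * c ^ (5 / 4 : ℝ)) * (b ^ (5 / 4 : ℝ) * d ^ (5 / 4 : ℝ))
      = (a ^ (5 / 4 : ℝ) * b ^ (5 / 4 : ℝ) * c ^ (1 / 2 : ℝ))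
        * (c ^ (3 / 4 : ℝ) * d ^ (5 / 4 : ℝ)) := by rw [hc5]; ring
    _ ≤ (M ^ (5 / 4 : ℝ) * M ^ (5 / 4 : ℝ) * M ^ (1 / 2 : ℝ))
        * (M' ^ (3 / 4 : ℝ) * M' ^ (5 / 4 : ℝ)) := by gcongr
    _ = M ^ 3 * M' ^ 2 := by rw [hM3, hM2]
    _ ≤ M ^ r * M' ^ s := by
      gcongr
      exacts [Nat.succ_le_of_lt hr, Nat.succ_le_of_lt hs]

/-- Absolute convergence of the double Eisenstein series over `m > m' > 0`. -/
lemma summable_doubleEisenstein {r s : ℕ} (hr : 2 < r) (hs : 1 < s) {τ : ℂ} (hτ : 0 < τ.im)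
    {P : ℤ × ℤ → Prop} (hP : ∀ p, P p → 0 < p.2 ∧ p.2 < p.1) :
    Summable fun y : {p : ℤ × ℤ // P p} × (ℤ × ℤ) ↦
      1 / ((y.1.1.1 : ℂ) * τ + (y.2.1 : ℂ)) ^ r *
        (1 / ((y.1.1.2 : ℂ) * τ + (y.2.2 : ℂ)) ^ s) := by
  obtain ⟨ρ, hρ, hbound⟩ := exists_mul_max_le_norm hτ
  let g : ℤ → ℝ := fun n ↦ (max |(n : ℝ)| 1) ^ (-(5 / 4) : ℝ)
  have hg : Summable g := summable_max_abs_one_rpow (by norm_num)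
  have hg0 : 0 ≤ g := fun n ↦ by positivity
  have hgg : Summable fun p : ℤ × ℤ ↦ g p.1 * g p.2 := hg.mul_of_nonneg hg hg0 hg0
  have hgg0 : 0 ≤ fun p : ℤ × ℤ ↦ g p.1 * g p.2 := fun p ↦ mul_nonneg (hg0 _) (hg0 _)
  have hsum : Summable fun y : {p : ℤ × ℤ // P p} × (ℤ × ℤ) ↦
      (ρ ^ (r + s))⁻¹ * ((g y.1.1.1 * g y.1.1.2) * (g y.2.1 * g y.2.2)) :=
    ((hgg.subtype {p | P p}).mul_of_nonneg hgg (fun p ↦ hgg0 p.1) hgg0).mul_left _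
  refine hsum.of_norm_bounded fun ⟨⟨⟨m, m'⟩, hp⟩, n, n'⟩ ↦ ?_
  obtain ⟨hm', hmm'⟩ := hP _ hp
  dsimp only at hm' hmm' ⊢
  have hm : 0 < m := hm'.trans hmm'
  have hm1 : (1 : ℝ) ≤ m := by exact_mod_cast hm
  have hm1' : (1 : ℝ) ≤ m' := by exact_mod_cast hm'
  have hmmR : (m' : ℝ) ≤ m := by exact_mod_cast hmm'.le
  have key := rpow_mul_le_pow_mul_pow (a := max |(m : ℝ)| 1) (b := max |(n : ℝ)| 1)
    (c := max |(m' : ℝ)| 1) (d := max |(n' : ℝ)| 1) (M := max (m : ℝ) |(n : ℝ)|)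
    (M' := max (m' : ℝ) |(n' : ℝ)|) hr hs (by simp) (by simp) (by simp) (by simp)
    (by grind) (by grind) (by grind) (by grind) (by grind)
  have hlow : ρ ^ (r + s) * (((max |(m : ℝ)| 1) ^ (5 / 4 : ℝ) * (max |(m' : ℝ)| 1) ^ (5 / 4 : ℝ)) *
      ((max |(n : ℝ)| 1) ^ (5 / 4 : ℝ) * (max |(n' : ℝ)| 1) ^ (5 / 4 : ℝ)))
      ≤ ‖(m : ℂ) * τ + n‖ ^ r * ‖(m' : ℂ) * τ + n'‖ ^ s := by
    calc _ ≤ ρ ^ (r + s) * (max (m : ℝ) |(n : ℝ)| ^ r * max (m' : ℝ) |(n' : ℝ)| ^ s) := by gcongr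
      _ = (ρ * max (m : ℝ) |(n : ℝ)|) ^ r * (ρ * max (m' : ℝ) |(n' : ℝ)|) ^ s := by ring
      _ ≤ _ := by
        gcongr
        exacts [hbound m n hm, hbound m' n' hm']
  have hinv := inv_anti₀ (by positivity) hlow
  have hgn (k : ℤ) : g k = ((max |(k : ℝ)| 1) ^ (5 / 4 : ℝ))⁻¹ :=
    Real.rpow_neg (by positivity) _
  simpa only [hgn, norm_mul, norm_inv, norm_pow, one_div, mul_inv] using hinv

/-- When `m` is even and `m'` odd, `mτ + n > m'τ + n' > 0` only constrains `m` and `m'`. -/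
def evenOddIndexEquiv :
    {p : ℤ × ℤ // 0 < p.2 ∧ p.2 < p.1 ∧ Even p.1 ∧ Odd p.2} × (ℤ × ℤ) ≃
    {x : (ℤ × ℤ) × (ℤ × ℤ) // Even x.1.1 ∧ Odd x.2.1 ∧
        posL (x.1.1 - x.2.1) (x.1.2 - x.2.2) ∧ posL x.2.1 x.2.2} where
  toFun y := ⟨((y.1.1.1, y.2.1), (y.1.1.2, y.2.2)),
    y.1.2.2.2.1, y.1.2.2.2.2, Or.inl (sub_pos.mpr y.1.2.2.1), Or.inl y.1.2.1⟩
  invFun x := (⟨(x.1.1.1, x.1.2.1), by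
    obtain ⟨⟨⟨m, n⟩, m', n'⟩, hm, hm', h1, h2⟩ := x
    simp only [posL] at hm hm' h1 h2 ⊢
    grind⟩, (x.1.1.2, x.1.2.2))
  left_inv _ := rfl
  right_inv _ := rfl

/-- Fourier expansion of `Z^{𝐞𝐨}_{r,s}`. -/
theorem ZeoSeries_eq (r s : ℕ) (hr : 2 < r) (hs : 1 < s) (τ : ℂ) (hτ : 0 < τ.im) :
    ZeoSeries r s τ = feo r s τ := by
  have hpi : (2 * (Real.pi : ℂ) * I) ≠ 0 := by simp [Real.pi_ne_zero]
  rw [ZeoSeries, feo, ← evenOddIndexEquiv.tsum_eq, inv_mul_eq_iff_eq_mul₀ (pow_ne_zero _ hpi),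
    ← tsum_mul_left]
  simp only [evenOddIndexEquiv, Equiv.coe_fn_mk, ← one_div_mul_one_div]
  rw [(summable_doubleEisenstein hr hs hτ fun p hp ↦ ⟨hp.1, hp.2.1⟩).tsum_prod]
  refine tsum_congr fun ⟨⟨m, m'⟩, hm', hmm', _⟩ ↦ ?_
  have him {k : ℤ} (hk : 0 < k) : 0 < ((k : ℂ) * τ).im := by
    simpa using mul_pos (Int.cast_pos.mpr hk) hτ
  rw [← tsum_mul_tsum_of_summable_norm (summable_one_div_add_int_pow (by omega) (m * τ)).norm
    (summable_one_div_add_int_pow hs (m' * τ)).norm,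
    tsum_one_div_add_int_pow (by omega) (him (hm'.trans hmm')),
    tsum_one_div_add_int_pow hs (him hm')]
  ring
end
end

section
/- For every τ ∈ ℍ and all complex numbers X, Y with Re X > 0, Re Y > 0 and e^X ≠ e^Y: Σ_{u,v≥1} e^{−uX−vY} (q^{2u}/(1−q^{2u}) + q^{2v}/(1−q^{2v})) · q^{u+v}/(1−q^{2(u+v)}) = F(X) F(Y) + (e^Y/(e^X−e^Y)) F(Y) − (e^X/(e^X−e^Y)) F(X). -/
noncomputable section

open Complex

/-- If `‖q‖ < 1`, the sequence `qⁿ / (1 - q²ⁿ)`, `n ≥ 1`, is bounded. -/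
theorem norm_pow_div_one_sub_pow_le {q : ℂ} (hq : ‖q‖ < 1) (n : ℕ) :
    ‖q ^ (n + 1) / (1 - q ^ (2 * (n + 1)))‖ ≤ (1 - ‖q‖)⁻¹ := by
  have hn : ‖q‖ ^ (n + 1) ≤ 1 := pow_le_one₀ (norm_nonneg q) hq.le
  have h2n : ‖q‖ ^ (2 * (n + 1)) ≤ ‖q‖ := pow_le_of_le_one (norm_nonneg q) hq.le (by omega)
  have hden : 1 - ‖q‖ ≤ ‖1 - q ^ (2 * (n + 1))‖ := by
    have h := norm_sub_norm_le (1 : ℂ) (q ^ (2 * (n + 1)))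
    rw [norm_one, norm_pow] at h
    linarith
  rw [norm_div, norm_pow, inv_eq_one_div]
  exact div_le_div₀ zero_le_one hn (sub_pos.2 hq) hden

/-- A power series with bounded coefficients converges absolutely on the open unit disc. -/
theorem summable_norm_pow_succ_mul {a : ℕ → ℂ} {C : ℝ} (ha : ∀ n, ‖a n‖ ≤ C) {x : ℂ}
    (hx : ‖x‖ < 1) : Summable fun n => ‖x ^ (n + 1) * a n‖ := by
  have hgeom : Summable fun n : ℕ => ‖x‖ ^ (n + 1) * C :=
    ((summable_nat_add_iff 1).2 (summable_geometric_of_lt_one (norm_nonneg x) hx)).mul_right C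
  refine hgeom.of_nonneg_of_le (fun n => norm_nonneg _) fun n => ?_
  rw [norm_mul, norm_pow]
  gcongr
  exact ha n

theorem summable_pow_succ_mul_pow_succ_mul {a : ℕ → ℂ} {C : ℝ} (ha : ∀ n, ‖a n‖ ≤ C) {x y : ℂ}
    (hx : ‖x‖ < 1) (hy : ‖y‖ < 1) :
    Summable fun p : ℕ × ℕ => x ^ (p.1 + 1) * y ^ (p.2 + 1) * a (p.1 + p.2 + 1) := by
  have hgeom : ∀ z : ℂ, ‖z‖ < 1 → Summable fun n : ℕ => ‖z ^ (n + 1)‖ := fun z hz =>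
    (summable_nat_add_iff 1).2 (summable_norm_geometric_of_norm_lt_one hz)
  have hxy := (hgeom x hx).mul_norm (hgeom y hy)
  refine Summable.of_norm_bounded (hxy.mul_right C) fun p => ?_
  rw [norm_mul _ (a _)]
  gcongr
  exact ha _

/-- Summing a double series whose coefficients depend only on `u + v` along antidiagonals. -/
theorem sub_mul_tsum_pow_succ_mul_pow_succ {a : ℕ → ℂ} {C : ℝ} (ha : ∀ n, ‖a n‖ ≤ C) {x y : ℂ}
    (hx : ‖x‖ < 1) (hy : ‖y‖ < 1) :
    (x - y) * ∑' p : ℕ × ℕ, x ^ (p.1 + 1) * y ^ (p.2 + 1) * a (p.1 + p.2 + 1) =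
      y * ∑' n, x ^ (n + 1) * a n - x * ∑' n, y ^ (n + 1) * a n := by
  have hsum := summable_pow_succ_mul_pow_succ_mul ha hx hy
  have hX := (summable_norm_pow_succ_mul ha hx).of_norm.mul_left y
  have hY := (summable_norm_pow_succ_mul ha hy).of_norm.mul_left x
  have hanti : ∀ n : ℕ,
      (x - y) * ∑ p ∈ Finset.HasAntidiagonal.antidiagonal n,
          x ^ (p.1 + 1) * y ^ (p.2 + 1) * a (p.1 + p.2 + 1) =
        y * (x ^ (n + 1 + 1) * a (n + 1)) - x * (y ^ (n + 1 + 1) * a (n + 1)) := fun n => by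
    have hterm : ∀ p ∈ Finset.HasAntidiagonal.antidiagonal n,
        x ^ (p.1 + 1) * y ^ (p.2 + 1) * a (p.1 + p.2 + 1) =
          x * y * a (n + 1) * (x ^ p.1 * y ^ p.2) := fun p hp => by
      rw [Finset.HasAntidiagonal.mem_antidiagonal.1 hp]
      ring
    rw [Finset.sum_congr rfl hterm, ← Finset.mul_sum,
      Finset.Nat.sum_antidiagonal_eq_sum_range_succ fun i j => x ^ i * y ^ j]
    have hgeom := geom_sum₂_mul x y (n + 1)
    simp only [Nat.add_sub_cancel] at hgeom
    linear_combination x * y * a (n + 1) * hgeom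
  have hsigma := Finset.HasAntidiagonal.sigmaAntidiagonalEquivProd.summable_iff.2 hsum
  rw [← Finset.HasAntidiagonal.sigmaAntidiagonalEquivProd.tsum_eq]
  refine (congrArg _ hsigma.tsum_sigma).trans ?_
  rw [← tsum_mul_left, ← tsum_mul_left, ← tsum_mul_left, ← hX.tsum_sub hY,
    (hX.sub hY).tsum_eq_zero_add]
  have hzero : y * (x ^ (0 + 1) * a 0) - x * (y ^ (0 + 1) * a 0) = 0 := by ring
  rw [hzero, zero_add]
  refine tsum_congr fun n => ?_
  rw [← hanti n, ← Finset.tsum_subtype]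
  rfl

/-- The partial fraction identity behind `sum_foo_symm`, with `s = qᵘ` and `t = qᵛ`. -/
theorem sq_div_add_sq_div_mul_eq {s t : ℂ} (hs : 1 - s ^ 2 ≠ 0) (ht : 1 - t ^ 2 ≠ 0)
    (hst : 1 - (s * t) ^ 2 ≠ 0) :
    (s ^ 2 / (1 - s ^ 2) + t ^ 2 / (1 - t ^ 2)) * (s * t / (1 - (s * t) ^ 2)) =
      s / (1 - s ^ 2) * (t / (1 - t ^ 2)) - s * t / (1 - (s * t) ^ 2) := by
  rw [div_add_div _ _ hs ht, div_mul_div_comm, div_mul_div_comm,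
    div_sub_div _ _ (mul_ne_zero hs ht) hst,
    div_eq_div_iff (mul_ne_zero (mul_ne_zero hs ht) hst) (mul_ne_zero (mul_ne_zero hs ht) hst)]
  ring

theorem norm_exp_neg_lt_one {W : ℂ} (hW : 0 < W.re) : ‖exp (-W)‖ < 1 := by
  rw [norm_exp, Real.exp_lt_one_iff, neg_re]
  linarith

theorem norm_exp_two_pi_I_mul_lt_one {τ : ℂ} (hτ : 0 < τ.im) :
    ‖exp (2 * ↑Real.pi * I * τ)‖ < 1 :=
  UpperHalfPlane.norm_exp_two_pi_I_lt_one ⟨τ, hτ⟩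

/-- generating-function identity used in the proof of the double
shuffle relations. Here `q = e^{2πiτ}` and
`F(W) = -∑_{u≥1} e^{-uW} q^u/(1-q^{2u})`. -/
theorem sum_foo_symm (τ : ℂ) (hτ : 0 < τ.im) (X Y : ℂ)
    (hX : 0 < X.re) (hY : 0 < Y.re) (hXY : Complex.exp X ≠ Complex.exp Y) :
    let q : ℂ := Complex.exp (2 * ↑Real.pi * Complex.I * τ)
    let F : ℂ → ℂ := fun W =>
      -∑' u : ℕ, Complex.exp (-((u : ℂ) + 1) * W) * q ^ (u + 1) / (1 - q ^ (2 * (u + 1)))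
    ∑' p : ℕ × ℕ,
        Complex.exp (-((p.1 : ℂ) + 1) * X - ((p.2 : ℂ) + 1) * Y) *
          (q ^ (2 * (p.1 + 1)) / (1 - q ^ (2 * (p.1 + 1))) +
            q ^ (2 * (p.2 + 1)) / (1 - q ^ (2 * (p.2 + 1)))) *
          (q ^ (p.1 + p.2 + 2) / (1 - q ^ (2 * (p.1 + p.2 + 2)))) =
      F X * F Y + (Complex.exp Y / (Complex.exp X - Complex.exp Y)) * F Y -
        (Complex.exp X / (Complex.exp X - Complex.exp Y)) * F X := by
  intro q F
  have hq : ‖q‖ < 1 := norm_exp_two_pi_I_mul_lt_one hτ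
  have hx := norm_exp_neg_lt_one hX
  have hy := norm_exp_neg_lt_one hY
  set a : ℕ → ℂ := fun n => q ^ (n + 1) / (1 - q ^ (2 * (n + 1)))
  have ha : ∀ n, ‖a n‖ ≤ (1 - ‖q‖)⁻¹ := norm_pow_div_one_sub_pow_le hq
  have hF : ∀ W, F W = -∑' n, exp (-W) ^ (n + 1) * a n := fun W => by
    refine congrArg Neg.neg (tsum_congr fun n => ?_)
    rw [← exp_nat_mul (-W), ← mul_div_assoc, Nat.cast_add_one, mul_neg, neg_mul]
  have hden : ∀ n : ℕ, 1 - (q ^ (n + 1)) ^ 2 ≠ 0 := fun n h => by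
    have hlt : ‖(q ^ (n + 1)) ^ 2‖ < 1 := by
      rw [← pow_mul, norm_pow]
      exact pow_lt_one₀ (norm_nonneg q) hq (by omega)
    rw [← sub_eq_zero.1 h, norm_one] at hlt
    exact lt_irrefl _ hlt
  have hterm : ∀ p : ℕ × ℕ,
      exp (-((p.1 : ℂ) + 1) * X - ((p.2 : ℂ) + 1) * Y) *
          (q ^ (2 * (p.1 + 1)) / (1 - q ^ (2 * (p.1 + 1))) +
            q ^ (2 * (p.2 + 1)) / (1 - q ^ (2 * (p.2 + 1)))) *
          (q ^ (p.1 + p.2 + 2) / (1 - q ^ (2 * (p.1 + p.2 + 2)))) =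
        exp (-X) ^ (p.1 + 1) * a p.1 * (exp (-Y) ^ (p.2 + 1) * a p.2) -
          exp (-X) ^ (p.1 + 1) * exp (-Y) ^ (p.2 + 1) * a (p.1 + p.2 + 1) := fun p => by
    have hexp : exp (-((p.1 : ℂ) + 1) * X - ((p.2 : ℂ) + 1) * Y) =
        exp (-X) ^ (p.1 + 1) * exp (-Y) ^ (p.2 + 1) := by
      rw [← exp_nat_mul, ← exp_nat_mul, ← exp_add]
      push_cast
      ring_nf
    have hadd : q ^ (p.1 + p.2 + 2) = q ^ (p.1 + 1) * q ^ (p.2 + 1) := by ring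
    have hpf := sq_div_add_sq_div_mul_eq (hden p.1) (hden p.2)
      (by rw [← hadd]; exact hden (p.1 + p.2 + 1))
    have hsq : ∀ n : ℕ, q ^ (2 * n) = (q ^ n) ^ 2 := fun n => by rw [mul_comm, pow_mul]
    simp only [a, hexp, hsq, show p.1 + p.2 + 1 + 1 = p.1 + p.2 + 2 from rfl, hadd]
    linear_combination exp (-X) ^ (p.1 + 1) * exp (-Y) ^ (p.2 + 1) * hpf
  have hsX := summable_norm_pow_succ_mul ha hx
  have hsY := summable_norm_pow_succ_mul ha hy
  have hmul := tsum_mul_tsum_of_summable_norm hsX hsY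
  have hdiag := sub_mul_tsum_pow_succ_mul_pow_succ ha hx hy
  rw [tsum_congr hterm, (hsX.mul_norm hsY).of_norm.tsum_sub
    (summable_pow_succ_mul_pow_succ_mul ha hx hy), ← hmul, hF, hF]
  have hXY' : exp X - exp Y ≠ 0 := sub_ne_zero.2 hXY
  have hX1 : exp X * exp (-X) = 1 := by rw [← exp_add, add_neg_cancel, exp_zero]
  have hY1 : exp Y * exp (-Y) = 1 := by rw [← exp_add, add_neg_cancel, exp_zero]
  generalize ∑' p : ℕ × ℕ, exp (-X) ^ (p.1 + 1) * exp (-Y) ^ (p.2 + 1) * a (p.1 + p.2 + 1) = D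
    at hdiag ⊢
  generalize ∑' n, exp (-X) ^ (n + 1) * a n = A at hdiag ⊢
  generalize ∑' n, exp (-Y) ^ (n + 1) * a n = B at hdiag ⊢
  have hD : D * (exp X - exp Y) = exp Y * B - exp X * A := by
    linear_combination (-exp X * exp Y) * hdiag +
      (exp Y * D + exp Y * B) * hX1 - (exp X * D + exp X * A) * hY1
  rw [eq_div_of_mul_eq hXY' hD]
  field_simp
  ring
end
end
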